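/- arXiv:0802.2475 — 3 statements merged into one kernel-verified Lean document; each statement's English description precedes it below -/
import Mathlib

section
/- Let f(z) = ∫₀¹ σ(t)dt/(1-tz) where σ ∈ C¹((0,1)) is positive, ∫₀¹ σ(t)dt = 1, and t·σ'(t)/σ(t) is decreasing on (0,1). Then for every x ∈ [0,1], the function z ↦ f(z)/f(xz) belongs to 𝒯, i.e., its Taylor coefficients at 0 form a Hausdorff moment sequence. -/
open MeasureTheory Complex

def SlitD (z : ℂ) : Prop := ¬(z.im = 0 ∧ 1 ≤ z.re)

lemma slit_ne {z : ℂ} (hz : SlitD z) {t : ℝ} (ht : t ∈ Set.Icc (0:ℝ) 1) : 1 - (t:ℂ) * z ≠ 0 := by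
  intro h
  apply hz
  have h1 := congrArg Complex.re h
  have h2 := congrArg Complex.im h
  simp at h1 h2
  obtain ⟨h0, h1'⟩ := ht
  have ht0 : t ≠ 0 := by rintro rfl; simp at h1
  refine ⟨h2.resolve_left ht0, ?_⟩
  by_contra hlt
  push Not at hlt
  have : 0 < t := lt_of_le_of_ne h0 (Ne.symm ht0)
  nlinarith

lemma slit_cont {z : ℂ} (hz : SlitD z) :
    Continuous (fun t : Set.Icc (0:ℝ) 1 => (1 - ((t:ℝ):ℂ) * z)⁻¹) := by
  apply Continuous.inv₀
  · fun_prop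
  · intro t
    exact slit_ne hz t.2

lemma cont_integrable {E : Type*} [NormedAddCommGroup E] {μ : Measure (Set.Icc (0:ℝ) 1)}
    [IsFiniteMeasure μ] {g : Set.Icc (0:ℝ) 1 → E} (hg : Continuous g) : Integrable g μ := by
  have := hg.continuousOn.integrableOn_compact (μ := μ) (isCompact_univ)
  simpa using this

lemma finish_measure (ν : Measure (Set.Icc (0:ℝ) 1)) [IsFiniteMeasure ν]
    (hb : ∀ n : ℕ, ∫ t : Set.Icc (0:ℝ) 1, (n:ℝ) / (1 + t * n) ∂ν ≤ 1) :
    ∃ μ : Measure (Set.Icc (0:ℝ) 1), IsProbabilityMeasure μ ∧ ∀ z, SlitD z →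
      ∫ t : Set.Icc (0:ℝ) 1, (1 - ((t:ℝ):ℂ) * z)⁻¹ ∂μ
        = 1 + ∫ t : Set.Icc (0:ℝ) 1, z * (1 - ((t:ℝ):ℂ) * z)⁻¹ ∂ν := by
  set d : Set.Icc (0:ℝ) 1 → ENNReal := fun t => (ENNReal.ofReal (t:ℝ))⁻¹ with hd
  have hdm : Measurable d := by fun_prop
  have hcn : ∀ n : ℕ, Continuous (fun t : Set.Icc (0:ℝ) 1 => (n:ℝ) / (1 + t * n)) := by
    intro n
    apply Continuous.div (by fun_prop) (by fun_prop)
    intro t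
    have := t.2.1
    positivity
  have hb' : ∀ n : ℕ, ∫⁻ t : Set.Icc (0:ℝ) 1, ENNReal.ofReal ((n:ℝ) / (1 + t * n)) ∂ν ≤ 1 := by
    intro n
    rw [← ofReal_integral_eq_lintegral_ofReal (cont_integrable (hcn n))]
    · rw [← ENNReal.ofReal_one]
      exact ENNReal.ofReal_le_ofReal (hb n)
    · filter_upwards with t
      have := t.2.1
      simp only [Pi.zero_apply]
      positivity
  have hlim : ∀ t : Set.Icc (0:ℝ) 1, Filter.Tendsto
      (fun n : ℕ => ENNReal.ofReal ((n:ℝ) / (1 + t * n))) Filter.atTop (nhds (d t)) := by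
    intro t
    rcases eq_or_lt_of_le t.2.1 with h | h
    · simp only [hd, ← h]
      simp
      exact ENNReal.tendsto_nat_nhds_top
    · have : d t = ENNReal.ofReal ((t:ℝ)⁻¹) := by
        simp only [hd]; rw [ENNReal.ofReal_inv_of_pos h]
      rw [this]
      apply ENNReal.tendsto_ofReal
      have h1 : Filter.Tendsto (fun n : ℕ => ((n:ℝ)⁻¹ + t)⁻¹) Filter.atTop (nhds ((0 + (t:ℝ))⁻¹)) := by
        apply Filter.Tendsto.inv₀
        · exact (tendsto_inv_atTop_nhds_zero_nat).add_const _
        · simpa using h.ne'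
      rw [zero_add] at h1
      refine h1.congr' ?_
      filter_upwards [Filter.eventually_gt_atTop 0] with n hn
      have : (0:ℝ) < n := by exact_mod_cast hn
      field_simp
  have hD : ∫⁻ t, d t ∂ν ≤ 1 := by
    calc ∫⁻ t, d t ∂ν = ∫⁻ t, Filter.liminf (fun n : ℕ => ENNReal.ofReal ((n:ℝ) / (1 + t * n))) Filter.atTop ∂ν := by
          congr 1; ext t; exact (hlim t).liminf_eq.symm
      _ ≤ Filter.liminf (fun n : ℕ => ∫⁻ t : Set.Icc (0:ℝ) 1, ENNReal.ofReal ((n:ℝ) / (1 + t * n)) ∂ν) Filter.atTop := by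
          apply lintegral_liminf_le
          intro n
          exact (hcn n).measurable.ennreal_ofReal
      _ ≤ 1 := by
          refine (Filter.liminf_le_liminf (v := fun _ => 1) (Filter.Eventually.of_forall hb')).trans ?_
          simp
  have hdlt : ∀ᵐ t ∂ν, d t < ⊤ :=
    ae_lt_top hdm (ne_of_lt (lt_of_le_of_lt hD ENNReal.one_lt_top))
  set κ := ν.withDensity d with hκ
  have hκu : κ Set.univ ≤ 1 := by simpa [hκ] using hD
  have : IsFiniteMeasure κ := ⟨lt_of_le_of_lt hκu ENNReal.one_lt_top⟩
  set z0 : Set.Icc (0:ℝ) 1 := ⟨0, by simp⟩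
  set c : ENNReal := 1 - κ Set.univ with hc
  have hc1 : c ≠ ⊤ := by rw [hc]; exact ENNReal.sub_ne_top ENNReal.one_ne_top
  refine ⟨κ + c • Measure.dirac z0, ⟨?_⟩, ?_⟩
  · simp [hc, add_tsub_cancel_of_le hκu]
  · intro z hz
    have : IsFiniteMeasure (c • Measure.dirac z0) := Measure.smul_finite _ hc1
    rw [integral_add_measure (cont_integrable (slit_cont hz)) (cont_integrable (slit_cont hz))]
    rw [integral_smul_measure, integral_dirac]
    have e1 : ∀ t : Set.Icc (0:ℝ) 1, (1 - ((t:ℝ):ℂ) * z)⁻¹ = 1 + ((t:ℝ):ℂ) * (z * (1 - ((t:ℝ):ℂ) * z)⁻¹) := by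
      intro t
      have := slit_ne hz t.2
      field_simp
      ring
    have hci : Continuous (fun t : Set.Icc (0:ℝ) 1 => ((t:ℝ):ℂ) * (z * (1 - ((t:ℝ):ℂ) * z)⁻¹)) := by
      have := slit_cont hz
      fun_prop
    rw [integral_congr_ae (Filter.Eventually.of_forall e1), integral_add (integrable_const _) (cont_integrable hci)]
    have e2 : ∫ t : Set.Icc (0:ℝ) 1, ((t:ℝ):ℂ) * (z * (1 - ((t:ℝ):ℂ) * z)⁻¹) ∂κ
        = ∫ t : Set.Icc (0:ℝ) 1, z * (1 - ((t:ℝ):ℂ) * z)⁻¹ ∂ν := by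
      rw [hκ, integral_withDensity_eq_integral_toReal_smul hdm hdlt]
      apply integral_congr_ae
      filter_upwards [hdlt] with t ht
      have ht0 : 0 < (t:ℝ) := by
        simp only [hd, ENNReal.inv_lt_top, ENNReal.ofReal_pos] at ht
        exact ht
      have : ((t:ℝ):ℂ) ≠ 0 := by exact_mod_cast ht0.ne'
      simp only [hd, ENNReal.toReal_inv, ENNReal.toReal_ofReal ht0.le, Complex.real_smul, Complex.ofReal_inv]
      field_simp
    rw [e2]
    have hcr : c.toReal = 1 - (κ Set.univ).toReal := by
      rw [hc, ENNReal.toReal_sub_of_le hκu ENNReal.one_ne_top]; simp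
    simp [z0, hcr, Measure.real]
    ring

/-- Robertson-type kernel formula. -/
lemma kernel_formula (g : ℂ → ℂ) (hg : DiffContOnCl ℂ g (Metric.ball 0 1))
    (hconj : ∀ w : ℂ, ‖w‖ = 1 → g ((starRingEnd ℂ) w) = (starRingEnd ℂ) (g w))
    (w : ℂ) (hw : ‖w‖ < 1) :
    g w = g 0 + (1 / Real.pi : ℝ) * ∫ θ in (0:ℝ)..2 * Real.pi,
      (((g (circleMap 0 1 θ)).im * Real.sin θ : ℝ) : ℂ) * (w / (1 - 2 * w * Real.cos θ + w ^ 2)) := by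
  have hpi : (Real.pi : ℂ) ≠ 0 := by exact_mod_cast Real.pi_ne_zero
  have hgc : ContinuousOn g (Metric.closedBall 0 1) := by
    have := hg.continuousOn
    rwa [closure_ball _ one_ne_zero] at this
  have hcm : Continuous (fun θ : ℝ => g (circleMap 0 1 θ)) := by
    apply hgc.comp_continuous (continuous_circleMap 0 1)
    intro θ
    simp [norm_circleMap_zero]
  have hζn : ∀ θ : ℝ, ‖circleMap 0 1 θ‖ = 1 := by intro θ; simp
  have hζ0 : ∀ θ : ℝ, circleMap 0 1 θ ≠ 0 := fun θ h => by
    have := hζn θ; rw [h] at this; simp at this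
  have hζw : ∀ θ : ℝ, circleMap 0 1 θ - w ≠ 0 := fun θ h => by
    have := hζn θ; rw [sub_eq_zero.1 h] at this; linarith
  have hwζ : ∀ u : ℂ, ‖u‖ ≤ 1 → 1 - w * u ≠ 0 := fun u hu h => by
    have h1 : ‖w * u‖ = 1 := by rw [← sub_eq_zero.1 h]; simp
    rw [norm_mul] at h1
    nlinarith [norm_nonneg w, norm_nonneg u]
  have C1 := hg.circleIntegral_sub_inv_smul (w := w) (by simpa using hw)
  have C0 := hg.circleIntegral_sub_inv_smul (w := 0) (by simp)
  have hg2 : DiffContOnCl ℂ (fun u => (1 - w * u)⁻¹ * g u) (Metric.ball 0 1) := by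
    apply DiffContOnCl.smul (𝕜' := ℂ) _ hg
    apply DiffContOnCl.inv
    · exact (Differentiable.diffContOnCl (by fun_prop))
    · intro x hx
      rw [closure_ball _ one_ne_zero] at hx
      exact hwζ x (by simpa using hx)
  have C2 : (∮ u in C(0, 1), (1 - w * u)⁻¹ * g u) = 0 := hg2.circleIntegral_eq_zero zero_le_one
  simp only [circleIntegral, deriv_circleMap, smul_eq_mul] at C1 C0 C2
  set G : ℝ → ℂ := fun θ => g (circleMap 0 1 θ) with hG
  have cζ : Continuous (circleMap 0 1) := continuous_circleMap 0 1
  have i1 : Continuous (fun θ : ℝ => circleMap 0 1 θ * I * ((circleMap 0 1 θ - w)⁻¹ * G θ)) :=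
    (cζ.mul continuous_const).mul (((cζ.sub continuous_const).inv₀ hζw).mul hcm)
  have i0 : Continuous (fun θ : ℝ => circleMap 0 1 θ * I * ((circleMap 0 1 θ - 0)⁻¹ * G θ)) :=
    (cζ.mul continuous_const).mul (((cζ.sub continuous_const).inv₀ (by simp)).mul hcm)
  have i2 : Continuous (fun θ : ℝ => circleMap 0 1 θ * I * ((1 - w * circleMap 0 1 θ)⁻¹ * G θ)) :=
    (cζ.mul continuous_const).mul (((continuous_const.sub (continuous_const.mul cζ)).inv₀
      (fun θ => hwζ _ (hζn θ).le)).mul hcm)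
  set K : ℝ → ℂ := fun θ => Real.sin θ * (w / (1 - 2 * w * Real.cos θ + w ^ 2)) with hK
  have hζe : ∀ θ : ℝ, circleMap 0 1 θ = Real.cos θ + Real.sin θ * I := by
    intro θ
    simp [circleMap, Complex.exp_mul_I]
  have hfac : ∀ θ : ℝ, (circleMap 0 1 θ - w) * (1 - w * circleMap 0 1 θ)
      = circleMap 0 1 θ * (1 - 2 * w * Real.cos θ + w ^ 2) := by
    intro θ
    rw [hζe]
    have hs : (Real.sin θ : ℂ) ^ 2 = 1 - (Real.cos θ : ℂ) ^ 2 := by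
      have := Real.sin_sq_add_cos_sq θ
      have h : (Real.sin θ : ℂ) ^ 2 + (Real.cos θ : ℂ) ^ 2 = 1 := by exact_mod_cast this
      linear_combination h
    linear_combination (-w * I ^ 2) * hs - w * (1 - (Real.cos θ : ℂ) ^ 2 ) * I_sq
  have hden : ∀ θ : ℝ, 1 - 2 * w * Real.cos θ + w ^ 2 ≠ 0 := by
    intro θ h
    have := hfac θ
    rw [h, mul_zero] at this
    rcases mul_eq_zero.1 this with h | h
    · exact hζw θ h
    · exact hwζ _ (hζn θ).le h
  have hKc : Continuous K := by
    apply Continuous.mul (by fun_prop)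
    apply Continuous.div (by fun_prop) (by fun_prop) hden
  -- pointwise identity
  have hpt : ∀ θ : ℝ, circleMap 0 1 θ * I * ((circleMap 0 1 θ - w)⁻¹ * G θ)
      - circleMap 0 1 θ * I * ((circleMap 0 1 θ - 0)⁻¹ * G θ)
      - w * (circleMap 0 1 θ * I * ((1 - w * circleMap 0 1 θ)⁻¹ * G θ)) = 2 * (G θ * K θ) := by
    intro θ
    have h1 := hζw θ
    have h2 := hwζ _ (hζn θ).le
    have h3 := hζ0 θ
    have h4 := hden θ
    have h5 := hfac θ
    have e : circleMap 0 1 θ * I * ((circleMap 0 1 θ - w)⁻¹ * G θ)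
      - circleMap 0 1 θ * I * ((circleMap 0 1 θ - 0)⁻¹ * G θ)
      - w * (circleMap 0 1 θ * I * ((1 - w * circleMap 0 1 θ)⁻¹ * G θ))
      = G θ * I * w * (1 - circleMap 0 1 θ ^ 2) / ((circleMap 0 1 θ - w) * (1 - w * circleMap 0 1 θ)) := by
      rw [sub_zero]
      have h2' : 1 - circleMap 0 1 θ * w ≠ 0 := by rwa [mul_comm]
      field_simp
      ring
    rw [e, h5]
    have e2 : (1 - circleMap 0 1 θ ^ 2) = - 2 * I * Real.sin θ * circleMap 0 1 θ := by
      rw [hζe]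
      have hs : (Real.sin θ : ℂ) ^ 2 + (Real.cos θ : ℂ) ^ 2 = 1 := by
        exact_mod_cast Real.sin_sq_add_cos_sq θ
      linear_combination - hs + (Real.sin θ : ℂ)^2 * I_sq
    rw [e2]
    simp only [hK]
    rw [show G θ * I * w * (-2 * I * Real.sin θ * circleMap 0 1 θ) = circleMap 0 1 θ * (-2 * I ^ 2 * (G θ * Real.sin θ * w)) by ring,
      mul_div_mul_left _ _ h3, I_sq]
    ring
  have main1 : ∫ θ in (0:ℝ)..2 * Real.pi, G θ * K θ = Real.pi * I * (g w - g 0) := by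
    have : ∫ θ in (0:ℝ)..2 * Real.pi, 2 * (G θ * K θ) = 2 * Real.pi * I * (g w - g 0) := by
      rw [← intervalIntegral.integral_congr (fun θ _ => hpt θ)]
      rw [intervalIntegral.integral_sub ((show Continuous (fun θ => circleMap 0 1 θ * I * ((circleMap 0 1 θ - w)⁻¹ * G θ) - circleMap 0 1 θ * I * ((circleMap 0 1 θ - 0)⁻¹ * G θ)) from i1.sub i0).intervalIntegrable _ _)
        ((show Continuous (fun θ => w * (circleMap 0 1 θ * I * ((1 - w * circleMap 0 1 θ)⁻¹ * G θ))) from continuous_const.mul i2).intervalIntegrable _ _),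
        intervalIntegral.integral_sub (i1.intervalIntegrable _ _) (i0.intervalIntegrable _ _),
        intervalIntegral.integral_const_mul, C1, C0, C2]
      ring
    rw [intervalIntegral.integral_const_mul] at this
    linear_combination this / 2
  have main2 : ∫ θ in (0:ℝ)..2 * Real.pi, (starRingEnd ℂ) (G θ) * K θ = - (Real.pi * I * (g w - g 0)) := by
    rw [← main1]
    have := intervalIntegral.integral_comp_sub_left (a := 0) (b := 2 * Real.pi)
      (fun θ => G θ * K θ) (2 * Real.pi)
    simp only [sub_self, sub_zero] at this
    rw [← this, ← intervalIntegral.integral_neg]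
    apply intervalIntegral.integral_congr
    intro θ _
    have h1 : circleMap 0 1 (2 * Real.pi - θ) = (starRingEnd ℂ) (circleMap 0 1 θ) := by
      rw [hζe, hζe, Real.cos_two_pi_sub, Real.sin_two_pi_sub]
      simp only [map_add, map_mul, conj_ofReal, conj_I]
      push_cast
      ring
    simp only [hG, hK]
    rw [h1, hconj _ (hζn θ), Real.cos_two_pi_sub, Real.sin_two_pi_sub]
    push_cast
    ring
  have hcc : Continuous (fun θ => (starRingEnd ℂ) (G θ)) := Complex.continuous_conj.comp hcm
  have main3 : ∫ θ in (0:ℝ)..2 * Real.pi, (2 * I) * ((((G θ).im * Real.sin θ : ℝ) : ℂ) * (w / (1 - 2 * w * Real.cos θ + w ^ 2)))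
      = 2 * Real.pi * I * (g w - g 0) := by
    have : ∀ θ : ℝ, (2 * I) * ((((G θ).im * Real.sin θ : ℝ) : ℂ) * (w / (1 - 2 * w * Real.cos θ + w ^ 2)))
      = G θ * K θ - (starRingEnd ℂ) (G θ) * K θ := by
      intro θ
      rw [← sub_mul, Complex.sub_conj]
      simp only [hK]
      push_cast
      ring
    rw [intervalIntegral.integral_congr (fun θ _ => this θ),
      intervalIntegral.integral_sub ((show Continuous (fun θ => G θ * K θ) from hcm.mul hKc).intervalIntegrable _ _)
        ((show Continuous (fun θ => (starRingEnd ℂ) (G θ) * K θ) from hcc.mul hKc).intervalIntegrable _ _), main1, main2]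
    ring
  rw [intervalIntegral.integral_const_mul] at main3
  have h2I : (2 * I : ℂ) ≠ 0 := by simp
  have main4 := mul_left_cancel₀ h2I (main3.trans (by ring : _ = 2 * I * (Real.pi * (g w - g 0))))
  simp only [hG] at main4
  rw [main4]
  push_cast
  field_simp
  ring

noncomputable def phi (w : ℂ) : ℂ := 4 * w / (1 + w) ^ 2

lemma one_add_ne {w : ℂ} (hw : ‖w‖ < 1) : 1 + w ≠ 0 := by
  intro h
  have : w = -1 := by linear_combination h
  rw [this] at hw
  simp at hw

lemma phi_im (w : ℂ) : (phi w).im = 4 * (1 - normSq w) / normSq (1 + w) ^ 2 * w.im := by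
  by_cases h : 1 + w = 0
  · simp [phi, h]
  · have h0 : normSq (1 + w) ≠ 0 := by simpa using h
    rw [phi, Complex.div_im]
    have h2 : normSq ((1 + w) ^ 2) = normSq (1 + w) ^ 2 := by simp
    rw [h2]
    field_simp
    simp [normSq_apply, pow_two]
    ring

lemma normSq_lt {w : ℂ} (hw : ‖w‖ < 1) : normSq w < 1 := by
  rw [normSq_eq_norm_sq]
  nlinarith [norm_nonneg w]

lemma phi_coef_pos {w : ℂ} (hw : ‖w‖ < 1) : 0 < 4 * (1 - normSq w) / normSq (1 + w) ^ 2 := by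
  have h1 := normSq_lt hw
  have h2 : 0 < normSq (1 + w) := by simpa using one_add_ne hw
  have : 0 < 1 - normSq w := by linarith
  positivity

lemma im_zero_of_phi {w : ℂ} (hw : ‖w‖ < 1) (h : (phi w).im = 0) : w.im = 0 := by
  rw [phi_im] at h
  exact (mul_eq_zero.1 h).resolve_left (phi_coef_pos hw).ne'

lemma phi_slit {w : ℂ} (hw : ‖w‖ < 1) : SlitD (phi w) := by
  rintro ⟨h1, h2⟩
  have h3 := im_zero_of_phi hw h1
  obtain ⟨a, rfl⟩ : ∃ a : ℝ, w = a := ⟨w.re, by apply Complex.ext <;> simp [h3]⟩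
  have e : phi (a:ℂ) = ((4 * a / (1 + a) ^ 2 : ℝ) : ℂ) := by simp [phi]
  rw [e, ofReal_re] at h2
  have ha : |a| < 1 := by simpa using hw
  rw [abs_lt] at ha
  have : 0 < (1 + a) ^ 2 := by have : 0 < 1 + a := by linarith
                               positivity
  rw [le_div_iff₀ this] at h2
  nlinarith [ha.1, ha.2, mul_pos (sub_pos.2 ha.2) (sub_pos.2 ha.2)]

lemma phi_surj {z : ℂ} (hz : SlitD z) : ∃ w : ℂ, ‖w‖ < 1 ∧ phi w = z := by
  obtain ⟨s, hs⟩ : ∃ s : ℂ, s ^ 2 = 1 - z := IsAlgClosed.exists_pow_nat_eq _ (by norm_num)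
  have key : ∀ s : ℂ, s ^ 2 = 1 - z → 0 < s.re → ∃ w : ℂ, ‖w‖ < 1 ∧ phi w = z := by
    intro s hs hre
    have h1 : 1 + s ≠ 0 := by
      intro h
      have := congrArg Complex.re h
      simp at this
      linarith
    refine ⟨(1 - s) / (1 + s), ?_, ?_⟩
    · rw [norm_div, div_lt_one (norm_pos_iff.2 h1)]
      apply lt_of_pow_lt_pow_left₀ 2 (norm_nonneg _)
      rw [← normSq_eq_norm_sq, ← normSq_eq_norm_sq, normSq_apply, normSq_apply]
      simp
      nlinarith
    · have e : 1 + (1 - s) / (1 + s) = 2 / (1 + s) := by field_simp; ring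
      rw [phi, e]
      field_simp
      linear_combination -4 * hs
  rcases lt_trichotomy s.re 0 with h | h | h
  · exact key (-s) (by rw [neg_sq, hs]) (by simpa using h)
  · exfalso
    apply hz
    have h1 := congrArg Complex.re hs
    have h2 := congrArg Complex.im hs
    simp [pow_two, h] at h1 h2
    exact ⟨h2, by nlinarith [mul_self_nonneg s.im]⟩
  · exact key s hs h

lemma phi_conj (w : ℂ) : phi ((starRingEnd ℂ) w) = (starRingEnd ℂ) (phi w) := by
  have h4 : (starRingEnd ℂ) 4 = 4 := Complex.conj_ofNat 4
  simp [phi, h4]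

lemma phi_diff {w : ℂ} (hw : ‖w‖ < 1) : DifferentiableAt ℂ phi w := by
  unfold phi
  have := one_add_ne hw
  apply DifferentiableAt.div (by fun_prop) (by fun_prop)
  exact pow_ne_zero _ this

noncomputable def Tmap (θ : ℝ) : Set.Icc (0:ℝ) 1 :=
  ⟨(1 + Real.cos θ) / 2, by constructor <;> linarith [Real.neg_one_le_cos θ, Real.cos_le_one θ]⟩

lemma Tmap_cont : Continuous Tmap := by
  unfold Tmap
  fun_prop

lemma phi_kernel {w : ℂ} (hw : ‖w‖ < 1) (θ : ℝ) :
    phi w * (1 - ((Tmap θ : ℝ) : ℂ) * phi w)⁻¹ = 4 * (w / (1 - 2 * w * Real.cos θ + w ^ 2)) := by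
  have h1 := one_add_ne hw
  have h2 := slit_ne (phi_slit hw) (Tmap θ).2
  have e : 1 - 2 * w * Real.cos θ + w ^ 2 = (1 + w) ^ 2 * (1 - ((Tmap θ : ℝ) : ℂ) * phi w) := by
    simp only [Tmap, phi]
    push_cast
    field_simp
    ring
  rw [e]
  generalize (1 - ((Tmap θ : ℝ) : ℂ) * phi w) = q at *
  unfold phi
  field_simp

lemma approx_measure (F : ℂ → ℂ) (hd : ∀ z, SlitD z → DifferentiableAt ℂ F z) (h0 : F 0 = 1)
    (hconj : ∀ z, SlitD z → F ((starRingEnd ℂ) z) = (starRingEnd ℂ) (F z))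
    (him : ∀ z, SlitD z → 0 ≤ z.im * (F z).im)
    (hpos : ∀ z, SlitD z → z.im = 0 → 0 ≤ (F z).re) (r : ℝ) (hr0 : 0 < r) (hr1 : r < 1) :
    ∃ μ : Measure (Set.Icc (0:ℝ) 1), IsProbabilityMeasure μ ∧ ∀ w : ℂ, ‖w‖ < 1 →
      F (phi (r * w)) = ∫ t : Set.Icc (0:ℝ) 1, (1 - ((t:ℝ):ℂ) * phi w)⁻¹ ∂μ := by
  have hrw : ∀ w : ℂ, ‖w‖ ≤ 1 → ‖(r:ℂ) * w‖ < 1 := by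
    intro w hw
    rw [norm_mul, norm_real, Real.norm_of_nonneg hr0.le]
    nlinarith [norm_nonneg w]
  set g : ℂ → ℂ := fun w => F (phi (r * w)) with hg
  have hgd : ∀ w : ℂ, ‖w‖ ≤ 1 → DifferentiableAt ℂ g w := by
    intro w hw
    have h1 : DifferentiableAt ℂ (fun w : ℂ => (r:ℂ) * w) w := by fun_prop
    have h2 : DifferentiableAt ℂ (fun w : ℂ => phi ((r:ℂ) * w)) w :=
      DifferentiableAt.comp (g := phi) w (phi_diff (hrw w hw)) h1
    exact DifferentiableAt.comp (g := F) w (hd _ (phi_slit (hrw w hw))) h2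
  have hgD : DiffContOnCl ℂ g (Metric.ball 0 1) := by
    apply DifferentiableOn.diffContOnCl
    rw [closure_ball _ one_ne_zero]
    intro w hw
    exact (hgd w (by simpa using hw)).differentiableWithinAt
  have hgc : ∀ w : ℂ, ‖w‖ = 1 → g ((starRingEnd ℂ) w) = (starRingEnd ℂ) (g w) := by
    intro w hw
    simp only [hg]
    rw [← hconj _ (phi_slit (hrw w hw.le)), ← phi_conj]
    simp
  have hker := kernel_formula g hgD hgc
  have hg0 : g 0 = 1 := by simp [hg, phi, h0]
  set ρ : ℝ → ℝ := fun θ => (1 / (4 * Real.pi)) * ((g (circleMap 0 1 θ)).im * Real.sin θ) with hρ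
  have hρ0 : ∀ θ, 0 ≤ ρ θ := by
    intro θ
    have hn : ‖circleMap 0 1 θ‖ ≤ 1 := by simp
    have h1 := him _ (phi_slit (hrw _ hn))
    rw [phi_im] at h1
    have h2 := phi_coef_pos (hrw _ hn)
    have h3 : ((r:ℂ) * circleMap 0 1 θ).im = r * Real.sin θ := by simp [circleMap, Complex.exp_im]
    rw [h3] at h1
    have h4 : 0 ≤ (g (circleMap 0 1 θ)).im * Real.sin θ := by
      by_contra hneg
      push Not at hneg
      have := mul_neg_of_pos_of_neg (mul_pos h2 hr0) hneg
      simp only [hg] at this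
      nlinarith
    have := Real.pi_pos
    simp only [hρ]
    positivity
  have hρc : Continuous ρ := by
    have hgcon : ContinuousOn g (Metric.closedBall 0 1) := fun w hw =>
      (hgd w (by simpa using hw)).continuousAt.continuousWithinAt
    have hcm : Continuous (fun θ : ℝ => g (circleMap 0 1 θ)) := by
      apply hgcon.comp_continuous (continuous_circleMap 0 1)
      intro θ
      simp [norm_circleMap_zero]
    exact continuous_const.mul ((Complex.continuous_im.comp hcm).mul Real.continuous_sin)
  set d : ℝ → ENNReal := fun θ => ENNReal.ofReal (ρ θ) with hdd
  have hdm : Measurable d := hρc.measurable.ennreal_ofReal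
  set ν0 := (volume.restrict (Set.Ioc 0 (2 * Real.pi))).withDensity d with hν0
  have hfin : IsFiniteMeasure ν0 := by
    apply isFiniteMeasure_withDensity_ofReal
    exact (hρc.integrableOn_Ioc).2
  set ν := ν0.map Tmap with hν
  have hνfin : IsFiniteMeasure ν := by rw [hν]; infer_instance
  have hrepr : ∀ w : ℂ, ‖w‖ < 1 →
      g w = 1 + ∫ t : Set.Icc (0:ℝ) 1, phi w * (1 - ((t:ℝ):ℂ) * phi w)⁻¹ ∂ν := by
    intro w hw
    have hc : Continuous (fun t : Set.Icc (0:ℝ) 1 => phi w * (1 - ((t:ℝ):ℂ) * phi w)⁻¹) :=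
      continuous_const.mul (slit_cont (phi_slit hw))
    rw [hν, integral_map Tmap_cont.aemeasurable hc.aestronglyMeasurable, hν0,
      integral_withDensity_eq_integral_toReal_smul hdm (by simp [hdd]), hker w hw, hg0,
      intervalIntegral.integral_of_le (by have := Real.pi_pos; positivity), ← integral_const_mul]
    congr 2
    ext θ
    rw [phi_kernel hw]
    rw [show (d θ).toReal = ρ θ from ENNReal.toReal_ofReal (hρ0 θ)]
    simp only [hρ, Complex.real_smul]
    have hpi : (Real.pi : ℂ) ≠ 0 := by exact_mod_cast Real.pi_ne_zero
    push_cast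
    field_simp
  obtain ⟨μ, hμ, hμz⟩ := finish_measure ν (by
    intro n
    have hz : SlitD (-(n:ℂ)) := by
      rintro ⟨-, h⟩
      simp at h
      have : (0:ℝ) ≤ n := Nat.cast_nonneg n
      linarith
    obtain ⟨w, hw, hwz⟩ := phi_surj hz
    have h1 := hrepr w hw
    rw [hwz] at h1
    have hwim := im_zero_of_phi hw (by rw [hwz]; simp)
    have h2 : 0 ≤ (g w).re := by
      apply hpos _ (phi_slit (hrw w hw.le))
      rw [phi_im]
      simp [hwim]
    have e : ∫ t : Set.Icc (0:ℝ) 1, -(n:ℂ) * (1 - ((t:ℝ):ℂ) * -(n:ℂ))⁻¹ ∂ν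
        = ((-∫ t : Set.Icc (0:ℝ) 1, (n:ℝ) / (1 + t * n) ∂ν : ℝ) : ℂ) := by
      rw [← integral_neg, ← integral_complex_ofReal]
      congr 1
      ext t
      push_cast
      rw [mul_neg, sub_neg_eq_add]
      ring
    rw [e] at h1
    rw [h1, add_re, ofReal_re, one_re] at h2
    linarith)
  refine ⟨μ, hμ, fun w hw => ?_⟩
  rw [hμz _ (phi_slit hw)]
  exact hrepr w hw

theorem pick_rep (F : ℂ → ℂ) (hd : ∀ z, SlitD z → DifferentiableAt ℂ F z) (h0 : F 0 = 1)
    (hconj : ∀ z, SlitD z → F ((starRingEnd ℂ) z) = (starRingEnd ℂ) (F z))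
    (him : ∀ z, SlitD z → 0 ≤ z.im * (F z).im)
    (hpos : ∀ z, SlitD z → z.im = 0 → 0 ≤ (F z).re) :
    ∃ μ : Measure ℝ, IsProbabilityMeasure μ ∧ μ (Set.Icc (0:ℝ) 1)ᶜ = 0 ∧
      ∀ z : ℂ, SlitD z → F z = ∫ t, (1 - (t:ℂ) * z)⁻¹ ∂μ := by
  set r : ℕ → ℝ := fun n => 1 - 1 / ((n:ℝ) + 2) with hr
  have hr0 : ∀ n, 0 < r n := by
    intro n
    have : (0:ℝ) ≤ n := Nat.cast_nonneg n
    simp only [hr, sub_pos]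
    rw [div_lt_one (by positivity)]
    linarith
  have hr1 : ∀ n, r n < 1 := by
    intro n
    have : (0:ℝ) ≤ n := Nat.cast_nonneg n
    have : 0 < 1 / ((n:ℝ) + 2) := by positivity
    simp only [hr]
    linarith
  have hrlim : Filter.Tendsto r Filter.atTop (nhds 1) := by
    have h := tendsto_one_div_add_atTop_nhds_zero_nat (𝕜 := ℝ)
    have h2 := (Filter.tendsto_add_atTop_iff_nat 1).2 h
    have h3 := h2.const_sub 1
    rw [sub_zero] at h3
    refine h3.congr (fun n => ?_)
    simp only [hr]
    push_cast
    ring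
  choose μ hμ hμw using fun n => approx_measure F hd h0 hconj him hpos (r n) (hr0 n) (hr1 n)
  set P : ℕ → ProbabilityMeasure (Set.Icc (0:ℝ) 1) := fun n => ⟨μ n, hμ n⟩ with hP
  obtain ⟨Q, -, hQ⟩ := (isCompact_univ (X := ProbabilityMeasure (Set.Icc (0:ℝ) 1))).ultrafilter_le_nhds
    ((Filter.hyperfilter ℕ).map P) (by simp)
  have hQ' : Filter.Tendsto P (Filter.hyperfilter ℕ : Filter ℕ) (nhds Q) := hQ
  rw [ProbabilityMeasure.tendsto_iff_forall_integral_rclike_tendsto ℂ] at hQ'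
  have hle : (Filter.hyperfilter ℕ : Filter ℕ) ≤ Filter.atTop := by
    rw [← Nat.cofinite_eq_atTop]; exact Filter.hyperfilter_le_cofinite
  refine ⟨(Q : Measure (Set.Icc (0:ℝ) 1)).map Subtype.val, ?_, ?_, ?_⟩
  · exact Measure.isProbabilityMeasure_map measurable_subtype_coe.aemeasurable
  · rw [Measure.map_apply measurable_subtype_coe measurableSet_Icc.compl]
    have : (Subtype.val ⁻¹' (Set.Icc (0:ℝ) 1)ᶜ : Set (Set.Icc (0:ℝ) 1)) = ∅ := by
      ext t
      simp
    rw [this]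
    simp
  · intro z hz
    rw [(MeasurableEmbedding.subtype_coe measurableSet_Icc).integral_map]
    obtain ⟨w, hw, rfl⟩ := phi_surj hz
    have l1 := hQ' (BoundedContinuousFunction.mkOfCompact ⟨_, slit_cont hz⟩)
    simp only [BoundedContinuousFunction.mkOfCompact_apply, ContinuousMap.coe_mk] at l1
    have l2 : Filter.Tendsto (fun n => F (phi (r n * w))) Filter.atTop (nhds (F (phi w))) := by
      have c1 : ContinuousAt (fun u => F (phi u)) w :=
        ((hd _ hz).comp w (phi_diff hw)).continuousAt
      have c2 : Filter.Tendsto (fun n => ((r n : ℝ) : ℂ) * w) Filter.atTop (nhds w) := by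
        have : Filter.Tendsto (fun n => ((r n : ℝ) : ℂ)) Filter.atTop (nhds ((1:ℝ):ℂ)) :=
          (continuous_ofReal.tendsto _).comp hrlim
        simpa using this.mul_const w
      exact c1.tendsto.comp c2
    have l3 := l2.mono_left hle
    refine tendsto_nhds_unique l3 (l1.congr (fun n => ?_))
    exact (hμw n w hw).symm

lemma slit_mul {z : ℂ} (hz : SlitD z) {x : ℝ} (hx : x ∈ Set.Icc (0:ℝ) 1) : SlitD ((x:ℂ) * z) := by
  rintro ⟨h1, h2⟩
  simp at h1 h2
  obtain ⟨hx0, hx1⟩ := hx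
  have hx' : x ≠ 0 := by
    rintro rfl
    simp at h2
    linarith
  apply hz
  refine ⟨h1.resolve_left hx', ?_⟩
  by_contra h
  push Not at h
  have : 0 < x := lt_of_le_of_ne hx0 (Ne.symm hx')
  nlinarith

lemma dens_int {a h : ℝ → ℝ} (ha : IntegrableOn a (Set.Ioo 0 1))
    (hh : ContinuousOn h (Set.Icc 0 1)) : IntegrableOn (fun t => a t * h t) (Set.Ioo 0 1) := by
  have h1 : IntegrableOn a (Set.Icc 0 1) := by rwa [integrableOn_Icc_iff_integrableOn_Ioo]
  exact (h1.mul_continuousOn hh isCompact_Icc).mono_set Set.Ioo_subset_Icc_self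

lemma dens_pos {h : ℝ → ℝ} (hi : IntegrableOn h (Set.Ioo 0 1))
    (hp : ∀ t ∈ Set.Ioo (0:ℝ) 1, 0 < h t) : 0 < ∫ t in Set.Ioo (0:ℝ) 1, h t := by
  rw [← integral_Ioc_eq_integral_Ioo, ← intervalIntegral.integral_of_le zero_le_one]
  apply intervalIntegral.intervalIntegral_pos_of_pos_on _ hp zero_lt_one
  rw [intervalIntegrable_iff_integrableOn_Ioo_of_le zero_le_one]
  exact hi

noncomputable def pz (z : ℂ) (t : ℝ) : ℝ := (normSq (1 - (t:ℂ) * z))⁻¹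

lemma pz_pos {z : ℂ} (hz : SlitD z) {t : ℝ} (ht : t ∈ Set.Icc (0:ℝ) 1) : 0 < pz z t := by
  have := slit_ne hz ht
  unfold pz
  rw [inv_pos]
  exact normSq_pos.2 this

lemma pz_cont {z : ℂ} (hz : SlitD z) : ContinuousOn (pz z) (Set.Icc 0 1) := by
  unfold pz
  apply ContinuousOn.inv₀
  · apply Continuous.continuousOn
    exact continuous_normSq.comp (by fun_prop)
  · intro t ht
    exact (normSq_pos.2 (slit_ne hz ht)).ne'

lemma stieltjes_eq {a : ℝ → ℝ} (ha : IntegrableOn a (Set.Ioo 0 1)) {z : ℂ} (hz : SlitD z) :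
    ∫ t in Set.Ioo (0:ℝ) 1, (a t : ℂ) * (1 - (t:ℂ) * z)⁻¹
      = ((∫ t in Set.Ioo (0:ℝ) 1, a t * pz z t : ℝ) : ℂ)
        - (starRingEnd ℂ) z * ((∫ t in Set.Ioo (0:ℝ) 1, a t * (t * pz z t) : ℝ) : ℂ) := by
  have i0 := dens_int ha (pz_cont hz)
  have i1 := dens_int ha (continuousOn_id.mul (pz_cont hz))
  rw [← integral_complex_ofReal, ← integral_complex_ofReal, ← integral_const_mul, ← integral_sub]
  · congr 1
    ext t
    rw [Complex.inv_def]
    simp only [pz]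
    push_cast
    simp only [map_sub, map_mul, map_one, conj_ofReal]
    ring
  · exact i0.ofReal
  · exact (Integrable.ofReal i1).const_mul _

lemma cheb {a b p : ℝ → ℝ} (ha : IntegrableOn a (Set.Ioo 0 1)) (hb : IntegrableOn b (Set.Ioo 0 1))
    (hpc : ContinuousOn p (Set.Icc 0 1)) (hp : ∀ t ∈ Set.Icc (0:ℝ) 1, 0 < p t)
    (hapos : ∀ t ∈ Set.Ioo (0:ℝ) 1, 0 < a t)
    (hcross : ∀ s t, 0 < s → s < t → t < 1 → b t * a s ≤ b s * a t) :
    (∫ t in Set.Ioo (0:ℝ) 1, b t * (t * p t)) * (∫ t in Set.Ioo (0:ℝ) 1, a t * p t)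
      ≤ (∫ t in Set.Ioo (0:ℝ) 1, a t * (t * p t)) * (∫ t in Set.Ioo (0:ℝ) 1, b t * p t) := by
  have hpc1 : ContinuousOn (fun t => t * p t) (Set.Icc 0 1) := continuousOn_id.mul hpc
  have a0 := dens_int ha hpc
  have a1 := dens_int ha hpc1
  have b0 := dens_int hb hpc
  have b1 := dens_int hb hpc1
  have A1pos := dens_pos a1 (fun t ht => mul_pos (hapos t ht) (mul_pos ht.1 (hp t ⟨ht.1.le, ht.2.le⟩)))
  have A0pos := dens_pos a0 (fun t ht => (mul_pos (hapos t ht) (hp t ⟨ht.1.le, ht.2.le⟩)))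
  have Adiff := dens_pos (a0.sub a1) (fun t ht => by
    have := mul_pos (hapos t ht) (hp t ⟨ht.1.le, ht.2.le⟩)
    have h2 := ht.2
    simp only [Pi.sub_apply]
    nlinarith)
  simp only [Pi.sub_apply] at Adiff
  rw [integral_sub a0 a1] at Adiff
  set A0 := ∫ t in Set.Ioo (0:ℝ) 1, a t * p t
  set A1 := ∫ t in Set.Ioo (0:ℝ) 1, a t * (t * p t)
  set B0 := ∫ t in Set.Ioo (0:ℝ) 1, b t * p t
  set B1 := ∫ t in Set.Ioo (0:ℝ) 1, b t * (t * p t)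
  set m := A1 / A0 with hm
  have hm0 : 0 < m := by positivity
  have hm1 : m < 1 := by rw [hm, div_lt_one A0pos]; linarith
  have hmA : m * A0 = A1 := by rw [hm]; field_simp
  have ham := hapos m ⟨hm0, hm1⟩
  have key : ∫ t in Set.Ioo (0:ℝ) 1, (a m * (b t * (t * p t)) - a m * m * (b t * p t)
      - (b m * (a t * (t * p t)) - b m * m * (a t * p t))) ≤ 0 := by
    apply setIntegral_nonpos measurableSet_Ioo
    intro t ht
    have hpt := hp t ⟨ht.1.le, ht.2.le⟩
    have e : a m * (b t * (t * p t)) - a m * m * (b t * p t)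
      - (b m * (a t * (t * p t)) - b m * m * (a t * p t)) = ((t - m) * (b t * a m - b m * a t)) * p t := by ring
    rw [e]
    apply mul_nonpos_of_nonpos_of_nonneg _ hpt.le
    rcases lt_trichotomy t m with h | h | h
    · have := hcross t m ht.1 h hm1
      nlinarith
    · rw [h]; simp
    · have := hcross m t hm0 h ht.2
      nlinarith
  have c1 := b1.const_mul (a m)
  have c2 := b0.const_mul (a m * m)
  have c3 := a1.const_mul (b m)
  have c4 := a0.const_mul (b m * m)
  have c12 : Integrable (fun t => a m * (b t * (t * p t)) - a m * m * (b t * p t)) (volume.restrict (Set.Ioo 0 1)) := c1.sub c2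
  have c34 : Integrable (fun t => b m * (a t * (t * p t)) - b m * m * (a t * p t)) (volume.restrict (Set.Ioo 0 1)) := c3.sub c4
  rw [integral_sub c12 c34, integral_sub c1 c2, integral_sub c3 c4] at key
  simp only [integral_const_mul] at key
  change a m * B1 - a m * m * B0 - (b m * A1 - b m * m * A0) ≤ 0 at key
  have k2 : a m * (B1 - m * B0) ≤ 0 := by
    have : b m * A1 - b m * m * A0 = 0 := by rw [← hmA]; ring
    linarith
  have k3 : B1 - m * B0 ≤ 0 := by
    by_contra h
    push Not at h
    have := mul_pos ham h
    linarith
  rw [← hmA]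
  nlinarith

lemma ratio_anti (σ : ℝ → ℝ)
    (hσC1 : ContDiffOn ℝ 1 σ (Set.Ioo 0 1))
    (hσpos : ∀ t ∈ Set.Ioo (0:ℝ) 1, 0 < σ t)
    (hdec : AntitoneOn (fun t => t * deriv σ t / σ t) (Set.Ioo 0 1))
    (x : ℝ) (hx0 : 0 < x) (hx1 : x ≤ 1) {s t : ℝ} (hs : 0 < s) (hst : s < t) (htx : t < x) :
    σ (t / x) * σ s ≤ σ (s / x) * σ t := by
  have hder : ∀ u ∈ Set.Ioo (0:ℝ) 1, HasDerivAt σ (deriv σ u) u := by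
    intro u hu
    exact ((hσC1.differentiableOn one_ne_zero).differentiableAt (isOpen_Ioo.mem_nhds hu)).hasDerivAt
  have hm : ∀ u ∈ Set.Ioo (0:ℝ) x, u ∈ Set.Ioo (0:ℝ) 1 ∧ u / x ∈ Set.Ioo (0:ℝ) 1 := by
    intro u hu
    refine ⟨⟨hu.1, hu.2.trans_le hx1⟩, div_pos hu.1 hx0, ?_⟩
    rw [div_lt_one hx0]; exact hu.2
  have hq : ∀ u ∈ Set.Ioo (0:ℝ) x, HasDerivAt (fun u => Real.log (σ (u / x)) - Real.log (σ u))
      (deriv σ (u / x) * (1 / x) / σ (u / x) - deriv σ u / σ u) u := by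
    intro u hu
    obtain ⟨h1, h2⟩ := hm u hu
    have d1 : HasDerivAt (fun u : ℝ => u / x) (1 / x) u := (hasDerivAt_id u).div_const x
    have d2 : HasDerivAt (fun u : ℝ => σ (u / x)) (deriv σ (u / x) * (1 / x)) u :=
      HasDerivAt.comp (h₂ := σ) u (hder _ h2) d1
    exact (d2.log (hσpos _ h2).ne').sub ((hder u h1).log (hσpos _ h1).ne')
  have hanti : AntitoneOn (fun u => Real.log (σ (u / x)) - Real.log (σ u)) (Set.Ioo 0 x) := by
    apply antitoneOn_of_deriv_nonpos (convex_Ioo 0 x)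
    · exact fun u hu => (hq u hu).continuousAt.continuousWithinAt
    · rw [interior_Ioo]
      exact fun u hu => (hq u hu).differentiableAt.differentiableWithinAt
    · rw [interior_Ioo]
      intro u hu
      rw [(hq u hu).deriv]
      obtain ⟨h1, h2⟩ := hm u hu
      have hle : u ≤ u / x := by rw [le_div_iff₀ hx0]; nlinarith [hu.1]
      have h3 := hdec h1 h2 hle
      simp only at h3
      have p1 := hσpos _ h1
      have p2 := hσpos _ h2
      have hu0 := hu.1
      have e : deriv σ (u / x) * (1 / x) / σ (u / x) - deriv σ u / σ u
        = (u / x * deriv σ (u / x) / σ (u / x) - u * deriv σ u / σ u) / u := by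
        field_simp
      rw [e]
      apply div_nonpos_of_nonpos_of_nonneg _ hu0.le
      linarith
  have ht : t ∈ Set.Ioo (0:ℝ) x := ⟨hs.trans hst, htx⟩
  have hs' : s ∈ Set.Ioo (0:ℝ) x := ⟨hs, hst.trans htx⟩
  have h := hanti hs' ht hst.le
  simp only at h
  have p1 := hσpos _ (hm t ht).1
  have p2 := hσpos _ (hm t ht).2
  have p3 := hσpos _ (hm s hs').1
  have p4 := hσpos _ (hm s hs').2
  rw [← Real.log_le_log_iff (by positivity) (by positivity), Real.log_mul p2.ne' p3.ne',
    Real.log_mul p4.ne' p1.ne']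
  linarith

lemma stieltjes_diff {a : ℝ → ℝ} (ha : IntegrableOn a (Set.Ioo 0 1)) {z : ℂ} (hz : SlitD z) :
    DifferentiableAt ℂ (fun z => ∫ t in Set.Ioo (0:ℝ) 1, (a t : ℂ) * (1 - (t:ℂ) * z)⁻¹) z := by
  obtain ⟨c, hc0, hc⟩ : ∃ c : ℝ, 0 < c ∧ ∀ t ∈ Set.Icc (0:ℝ) 1, c ≤ ‖1 - (t:ℂ) * z‖ := by
    have hcont : ContinuousOn (fun t : ℝ => ‖1 - (t:ℂ) * z‖) (Set.Icc 0 1) := by fun_prop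
    obtain ⟨t0, ht0, hmin⟩ := isCompact_Icc.exists_isMinOn ⟨0, by simp⟩ hcont
    exact ⟨_, norm_pos_iff.2 (slit_ne hz ht0), fun t ht => hmin ht⟩
  have hlow : ∀ t ∈ Set.Icc (0:ℝ) 1, ∀ u ∈ Metric.ball z (c / 2), c / 2 ≤ ‖1 - (t:ℂ) * u‖ := by
    intro t ht u hu
    have h1 := hc t ht
    have h2 : ‖(t:ℂ) * (u - z)‖ ≤ c / 2 := by
      rw [norm_mul, norm_real, Real.norm_of_nonneg ht.1]
      rw [mem_ball_iff_norm] at hu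
      nlinarith [norm_nonneg (u - z), ht.1, ht.2]
    have h3 : 1 - (t:ℂ) * z = (1 - (t:ℂ) * u) + (t:ℂ) * (u - z) := by ring
    have h4 := norm_add_le (1 - (t:ℂ) * u) ((t:ℂ) * (u - z))
    rw [← h3] at h4
    linarith
  have hne : ∀ t ∈ Set.Icc (0:ℝ) 1, ∀ u ∈ Metric.ball z (c / 2), 1 - (t:ℂ) * u ≠ 0 := by
    intro t ht u hu
    rw [← norm_pos_iff]
    linarith [hlow t ht u hu]
  have hmeas : ∀ u : ℂ, Measurable (fun t : ℝ => (1 - (t:ℂ) * u)⁻¹) := by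
    intro u
    fun_prop
  have ham : AEStronglyMeasurable (fun t => (a t : ℂ)) (volume.restrict (Set.Ioo (0:ℝ) 1)) :=
    (Integrable.ofReal ha).aestronglyMeasurable
  have := hasDerivAt_integral_of_dominated_loc_of_deriv_le (μ := volume.restrict (Set.Ioo (0:ℝ) 1))
    (F := fun u t => (a t : ℂ) * (1 - (t:ℂ) * u)⁻¹)
    (F' := fun u t => (a t : ℂ) * ((t:ℂ) / (1 - (t:ℂ) * u) ^ 2)) (x₀ := z)
    (bound := fun t => ‖a t‖ * (1 / (c / 2) ^ 2))
    (Metric.ball_mem_nhds z (half_pos hc0)) ?_ ?_ ?_ ?_ ?_ ?_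
  · exact this.2.differentiableAt
  · filter_upwards with u
    exact ham.mul (hmeas u).aestronglyMeasurable
  · have hz' : ContinuousOn (fun t : ℝ => (1 - (t:ℂ) * z)⁻¹) (Set.Icc 0 1) := by
      apply ContinuousOn.inv₀ (by fun_prop)
      intro t ht
      exact slit_ne hz ht
    have h1 : IntegrableOn (fun t => (a t : ℂ)) (Set.Icc 0 1) := by
      rw [integrableOn_Icc_iff_integrableOn_Ioo]; exact Integrable.ofReal ha
    exact (h1.mul_continuousOn hz' isCompact_Icc).mono_set Set.Ioo_subset_Icc_self
  · apply ham.mul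
    apply Measurable.aestronglyMeasurable
    fun_prop
  · rw [ae_restrict_iff' measurableSet_Ioo]
    filter_upwards with t ht u hu
    have ht' : t ∈ Set.Icc (0:ℝ) 1 := ⟨ht.1.le, ht.2.le⟩
    rw [norm_mul, norm_real, norm_div, norm_pow]
    gcongr
    · rw [norm_real, Real.norm_of_nonneg ht.1.le]; exact ht.2.le
    · exact hlow t ht' u hu
  · exact ha.norm.mul_const _
  · rw [ae_restrict_iff' measurableSet_Ioo]
    filter_upwards with t ht u hu
    have ht' : t ∈ Set.Icc (0:ℝ) 1 := ⟨ht.1.le, ht.2.le⟩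
    have d1 : HasDerivAt (fun u : ℂ => 1 - (t:ℂ) * u) (-(t:ℂ)) u := by
      simpa using ((hasDerivAt_id u).const_mul (t:ℂ)).const_sub 1
    have d2 := (d1.inv (hne t ht' u hu)).const_mul (a t : ℂ)
    simpa using d2

theorem stmt8 (σ : ℝ → ℝ)
    (hσC1 : ContDiffOn ℝ 1 σ (Set.Ioo 0 1))
    (hσpos : ∀ t ∈ Set.Ioo (0:ℝ) 1, 0 < σ t)
    (hσint : ∫ t in Set.Ioo (0:ℝ) 1, σ t = 1)
    (hdec : AntitoneOn (fun t => t * deriv σ t / σ t) (Set.Ioo 0 1))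
    (f : ℂ → ℂ)
    (hf : ∀ z : ℂ, f z = ∫ t in Set.Ioo (0:ℝ) 1, (σ t : ℂ) * (1 - (t:ℂ) * z)⁻¹)
    (x : ℝ) (hx : x ∈ Set.Icc (0:ℝ) 1) :
    ∃ μ : Measure ℝ, IsProbabilityMeasure μ ∧ μ (Set.Icc (0:ℝ) 1)ᶜ = 0 ∧
      ∀ z : ℂ, ¬(z.im = 0 ∧ 1 ≤ z.re) →
        f z / f ((x:ℂ) * z) = ∫ t, (1 - (t:ℂ) * z)⁻¹ ∂μ := by
  have hσi : IntegrableOn σ (Set.Ioo 0 1) := by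
    by_contra h
    rw [integral_undef h] at hσint
    exact zero_ne_one hσint
  have hf0 : f 0 = 1 := by
    rw [hf]
    simp only [mul_zero, sub_zero, inv_one, mul_one]
    rw [integral_complex_ofReal, hσint, ofReal_one]
  set A0 : ℂ → ℝ := fun z => ∫ t in Set.Ioo (0:ℝ) 1, σ t * pz z t with hA0
  set A1 : ℂ → ℝ := fun z => ∫ t in Set.Ioo (0:ℝ) 1, σ t * (t * pz z t) with hA1
  have hfA : ∀ z, SlitD z → f z = (A0 z : ℂ) - (starRingEnd ℂ) z * (A1 z : ℂ) := by
    intro z hz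
    rw [hf, stieltjes_eq hσi hz]
  have hA1pos : ∀ z, SlitD z → 0 < A1 z := by
    intro z hz
    exact dens_pos (dens_int hσi (continuousOn_id.mul (pz_cont hz))) (fun t ht =>
      mul_pos (hσpos t ht) (mul_pos ht.1 (pz_pos hz ⟨ht.1.le, ht.2.le⟩)))
  have hA01 : ∀ z, SlitD z → A1 z < A0 z := by
    intro z hz
    have i1 := dens_int hσi (continuousOn_id.mul (pz_cont hz))
    have i0 := dens_int hσi (pz_cont hz)
    have := dens_pos (i0.sub i1) (fun t ht => by
      have h1 := mul_pos (hσpos t ht) (pz_pos hz ⟨ht.1.le, ht.2.le⟩)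
      have h2 := ht.2
      simp only [Pi.sub_apply, Pi.mul_apply, id]
      nlinarith)
    simp only [Pi.sub_apply] at this
    rw [integral_sub i0 i1] at this
    exact sub_pos.1 this
  have hfim : ∀ z, SlitD z → (f z).im = z.im * A1 z := by
    intro z hz
    rw [hfA z hz]; simp
  have hfre : ∀ z, SlitD z → z.im = 0 → 0 < (f z).re := by
    intro z hz h0
    rw [hfA z hz]
    simp
    have h1 := hA1pos z hz
    have h2 := hA01 z hz
    have h3 : z.re < 1 := by
      by_contra h
      exact hz ⟨h0, not_lt.1 h⟩
    nlinarith
  have hfne : ∀ z, SlitD z → f z ≠ 0 := by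
    intro z hz h
    by_cases h0 : z.im = 0
    · have := hfre z hz h0
      rw [h] at this; simp at this
    · have := hfim z hz
      rw [h] at this
      simp at this
      rcases this with h1 | h1
      · exact h0 h1
      · exact (hA1pos z hz).ne' h1
  have hfconj : ∀ z, f ((starRingEnd ℂ) z) = (starRingEnd ℂ) (f z) := by
    intro z
    rw [hf, hf, ← integral_conj]
    congr 1
    ext t
    simp
  have hfd : ∀ z, SlitD z → DifferentiableAt ℂ f z := by
    intro z hz
    have : f = fun z => ∫ t in Set.Ioo (0:ℝ) 1, (σ t : ℂ) * (1 - (t:ℂ) * z)⁻¹ := funext hf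
    rw [this]
    exact stieltjes_diff hσi hz
  have himcore : ∀ z, SlitD z → 0 ≤ z.im * (f z * (starRingEnd ℂ) (f (x * z))).im := by
    intro z hz
    rcases eq_or_lt_of_le hx.1 with h | hx0
    · rw [← h]
      simp only [ofReal_zero, zero_mul, hf0, map_one, mul_one]
      rw [hfim z hz]
      have := hA1pos z hz
      nlinarith [mul_self_nonneg z.im, mul_nonneg (mul_self_nonneg z.im) this.le]
    set S : ℝ → ℝ := Set.indicator (Set.Ioo 0 1) σ with hS
    set B : ℝ → ℝ := Set.indicator (Set.Ioo 0 x) (fun u => σ (u / x)) with hB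
    have hBS : ∀ s, B (s * x) = S s := by
      intro s
      simp only [hB, hS, Set.indicator, Set.mem_Ioo]
      have e1 : (0 < s * x ∧ s * x < x) ↔ (0 < s ∧ s < 1) := by
        constructor
        · rintro ⟨h1, h2⟩
          exact ⟨pos_of_mul_pos_left h1 hx0.le, by nlinarith⟩
        · rintro ⟨h1, h2⟩
          exact ⟨mul_pos h1 hx0, by nlinarith⟩
      simp only [e1]
      rw [mul_div_assoc, div_self hx0.ne', mul_one]
    have hSi : Integrable S := by
      rw [hS, integrable_indicator_iff measurableSet_Ioo]; exact hσi
    have hBi : Integrable B := by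
      rw [← integrable_comp_mul_right_iff B hx0.ne']
      simpa only [hBS] using hSi
    have hfx : f (x * z) = (x⁻¹ : ℝ) * ∫ t in Set.Ioo (0:ℝ) 1, (B t : ℂ) * (1 - (t:ℂ) * z)⁻¹ := by
      have e1 : f (x * z) = ∫ s : ℝ, (B (s * x) : ℂ) * (1 - ((s * x : ℝ):ℂ) * z)⁻¹ := by
        rw [hf, ← integral_indicator measurableSet_Ioo]
        congr 1
        ext s
        rw [hBS]
        simp only [hS, Set.indicator]
        split_ifs
        · push_cast; ring_nf
        · simp
      rw [e1, Measure.integral_comp_mul_right (fun u : ℝ => (B u : ℂ) * (1 - (u:ℂ) * z)⁻¹) x,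
        abs_of_pos (inv_pos.2 hx0), Complex.real_smul]
      congr 1
      symm
      apply setIntegral_eq_integral_of_forall_compl_eq_zero
      intro t ht
      have : B t = 0 := by
        simp only [hB]
        apply Set.indicator_of_notMem
        exact fun h => ht ⟨h.1, h.2.trans_le hx.2⟩
      rw [this]; simp
    have hcross : ∀ s t, 0 < s → s < t → t < 1 → B t * σ s ≤ B s * σ t := by
      intro s t hs hst ht1
      by_cases htx : t < x
      · have h1 : B t = σ (t / x) := Set.indicator_of_mem (show t ∈ Set.Ioo 0 x from ⟨hs.trans hst, htx⟩) _
        have h2 : B s = σ (s / x) := Set.indicator_of_mem (show s ∈ Set.Ioo 0 x from ⟨hs, hst.trans htx⟩) _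
        rw [h1, h2]
        exact ratio_anti σ hσC1 hσpos hdec x hx0 hx.2 hs hst htx
      · have h1 : B t = 0 := Set.indicator_of_notMem (fun h => htx h.2) _
        have h2 : 0 ≤ B s := by
          apply Set.indicator_nonneg
          intro u hu
          exact (hσpos _ ⟨div_pos hu.1 hx0, by rw [div_lt_one hx0]; exact hu.2⟩).le
        rw [h1, zero_mul]
        exact mul_nonneg h2 (hσpos t ⟨hs.trans hst, ht1⟩).le
    have hch := cheb hσi hBi.integrableOn (pz_cont hz) (fun t ht => pz_pos hz ht) hσpos hcross
    rw [hfx, stieltjes_eq hBi.integrableOn hz, hfA z hz]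
    change _ * A0 z ≤ A1 z * _ at hch
    generalize (∫ t in Set.Ioo (0:ℝ) 1, B t * pz z t) = B0 at *
    generalize (∫ t in Set.Ioo (0:ℝ) 1, B t * (t * pz z t)) = B1 at *
    have e : (((A0 z : ℂ) - (starRingEnd ℂ) z * (A1 z : ℂ)) * (starRingEnd ℂ) ((x⁻¹ : ℝ) * ((B0 : ℂ) - (starRingEnd ℂ) z * (B1 : ℂ)))).im
        = z.im * (x⁻¹ * (A1 z * B0 - B1 * A0 z)) := by
      simp only [map_mul, map_sub, conj_ofReal, conj_conj, mul_im, sub_im, sub_re, mul_re, ofReal_re, ofReal_im, conj_re, conj_im]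
      ring
    rw [e, ← mul_assoc]
    apply mul_nonneg (mul_self_nonneg _)
    exact mul_nonneg (inv_pos.2 hx0).le (sub_nonneg.2 hch)
  apply pick_rep (fun z => f z / f (x * z))
  · intro z hz
    apply DifferentiableAt.div (hfd z hz)
    · exact DifferentiableAt.comp (g := f) z (hfd _ (slit_mul hz hx)) (by fun_prop)
    · exact hfne _ (slit_mul hz hx)
  · simp [hf0]
  · intro z hz
    simp only [map_div₀]
    rw [← hfconj, ← hfconj]
    simp
  · intro z hz
    have h := himcore z hz
    have e : (f z / f (x * z)).im = (f z * (starRingEnd ℂ) (f (x * z))).im * (normSq (f (x * z)))⁻¹ := by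
      rw [div_eq_mul_inv, Complex.inv_def, ← mul_assoc, im_mul_ofReal]
    rw [e, ← mul_assoc]
    exact mul_nonneg h (inv_nonneg.2 (normSq_nonneg _))
  · intro z hz h0
    have h1 := hfre z hz h0
    have h2 : 0 < (f (x * z)).re := hfre _ (slit_mul hz hx) (by simp [h0])
    have h3 : (f z).im = 0 := by rw [hfim z hz, h0, zero_mul]
    rw [Complex.div_re, h3]
    simp only [zero_mul, zero_div, add_zero]
    exact div_nonneg (mul_nonneg h1.le h2.le) (normSq_nonneg _)
end

section
/- If f ∈ 𝒯 and δ > 0, then the function z ↦ f(z-δ)/f(-δ) belongs to 𝒯. -/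
open MeasureTheory Complex

/-- Membership in the class 𝒯 of generating functions of Hausdorff moment
sequences: `f` is represented by a Borel probability measure on `[0,1]` on the
slit plane `ℂ \ [1,∞)`. -/
def MemT (f : ℂ → ℂ) : Prop :=
  ∃ μ : Measure ℝ, IsProbabilityMeasure μ ∧ μ (Set.Icc (0:ℝ) 1)ᶜ = 0 ∧
    ∀ z : ℂ, ¬(z.im = 0 ∧ 1 ≤ z.re) → f z = ∫ t, (1 - (t:ℂ) * z)⁻¹ ∂μ

theorem stmt12 (f : ℂ → ℂ) (hf : MemT f) (δ : ℝ) (hδ : 0 < δ) :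
    MemT (fun z => f (z - (δ:ℂ)) / f (-(δ:ℂ))) := by
  obtain ⟨μ, hμ, hsupp, hfz⟩ := hf
  have hae : ∀ᵐ t ∂μ, t ∈ Set.Icc (0:ℝ) 1 := by
    rw [ae_iff]; exact hsupp
  set g : ℝ → ℝ := fun t => (1 + t * δ)⁻¹ with hg
  have hgm : Measurable g := by fun_prop
  have hg0 : ∀ t ∈ Set.Icc (0:ℝ) 1, (1 + δ)⁻¹ ≤ g t ∧ g t ≤ 1 := by
    intro t ht
    have h1 : 0 ≤ t * δ := mul_nonneg ht.1 hδ.le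
    have h2 : t * δ ≤ δ := by nlinarith [ht.2]
    constructor
    · exact inv_anti₀ (by positivity) (by linarith)
    · exact inv_le_one_of_one_le₀ (by linarith)
  have hδ' : 0 < (1 + δ)⁻¹ := by positivity
  have hint : Integrable g μ := by
    refine Integrable.of_bound hgm.aestronglyMeasurable 1 ?_
    filter_upwards [hae] with t ht
    have := hg0 t ht
    rw [Real.norm_eq_abs, abs_of_nonneg (by linarith)]
    exact this.2
  set c : ℝ := ∫ t, g t ∂μ with hc
  have hcpos : 0 < c := by
    have : ∫ _t, (1 + δ)⁻¹ ∂μ ≤ c := by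
      refine integral_mono_ae (integrable_const _) hint ?_
      filter_upwards [hae] with t ht
      exact (hg0 t ht).1
    simp at this
    exact lt_of_lt_of_le (by simpa using hδ') this
  have hfδ : f (-(δ:ℂ)) = (c:ℂ) := by
    rw [hfz _ (by simp; linarith), hc, ← integral_complex_ofReal]
    congr 1
    ext t
    simp [hg]
  set w : ℝ → NNReal := fun t => Real.toNNReal (g t / c) with hw
  have hwm : Measurable w := by fun_prop
  set φ : ℝ → ℝ := fun t => t * g t with hφ
  have hφm : Measurable φ := by fun_prop
  have hφI : ∀ t ∈ Set.Icc (0:ℝ) 1, φ t ∈ Set.Icc (0:ℝ) 1 := by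
    intro t ht
    have := hg0 t ht
    have h3 : 0 ≤ g t := by linarith
    exact ⟨mul_nonneg ht.1 h3, mul_le_one₀ ht.2 h3 this.2⟩
  refine ⟨(μ.withDensity (fun t => (w t : ENNReal))).map φ, ?_, ?_, ?_⟩
  · have : IsProbabilityMeasure (μ.withDensity (fun t => (w t : ENNReal))) := by
      constructor
      rw [withDensity_apply _ MeasurableSet.univ, Measure.restrict_univ]
      have : ∫⁻ t, ENNReal.ofReal (g t / c) ∂μ = 1 := by
        rw [← ofReal_integral_eq_lintegral_ofReal (hint.div_const c), integral_div, ← hc,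
          div_self hcpos.ne', ENNReal.ofReal_one]
        filter_upwards [hae] with t ht
        have := hg0 t ht
        exact div_nonneg (by linarith) hcpos.le
      exact this
    exact Measure.isProbabilityMeasure_map hφm.aemeasurable
  · have h1 : ∀ᵐ t ∂(μ.withDensity (fun t => (w t : ENNReal))), φ t ∈ Set.Icc (0:ℝ) 1 := by
      refine (withDensity_absolutelyContinuous _ _).ae_le ?_
      filter_upwards [hae] with t ht using hφI t ht
    rw [Measure.map_apply hφm measurableSet_Icc.compl]
    exact h1
  · intro z hz
    have hz' : ¬((z - (δ:ℂ)).im = 0 ∧ 1 ≤ (z - (δ:ℂ)).re) := by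
      rintro ⟨h1, h2⟩
      simp at h1 h2
      exact hz ⟨h1, by linarith⟩
    have hm : Measurable (fun t : ℝ => (1 - (t:ℂ) * z)⁻¹) := by fun_prop
    rw [integral_map hφm.aemeasurable hm.aestronglyMeasurable,
      integral_withDensity_eq_integral_smul hwm]
    simp only
    rw [hfδ, hfz _ hz', ← integral_div]
    refine integral_congr_ae ?_
    filter_upwards [hae] with t ht
    have hgt := hg0 t ht
    have h4 : 0 ≤ g t / c := div_nonneg (by linarith) hcpos.le
    have h5 : (1 + (t:ℂ) * δ) ≠ 0 := by
      have : 0 < 1 + t * δ := by nlinarith [mul_nonneg ht.1 hδ.le]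
      exact_mod_cast this.ne'
    rw [NNReal.smul_def, hw]
    simp only
    rw [Real.coe_toNNReal _ h4, Complex.real_smul]
    have h6 : 1 - (t:ℂ) * (z - δ) = (1 + (t:ℂ) * δ) * (1 - (φ t : ℂ) * z) := by
      simp only [hφ, hg]
      push_cast
      field_simp
      ring
    rw [h6, mul_inv]
    simp only [hg]
    push_cast
    ring
end

section
/- A sequence {aₖ}ₖ≥₀ of nonnegative reals with a₀ = 1 is a Hausdorff moment sequence (aₖ = ∫₀¹ tᵏ dμ(t) for some Borel probability measure μ on [0,1]) if and only if it is completely monotone, i.e., (Δⁿa)ₖ ≥ 0 for all k ≥ 0, n ≥ 0, where (Δa)ₖ = aₖ - aₖ₊₁ and Δⁿ is the n-fold iterate. -/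
open MeasureTheory

/-- The forward difference operator `(Δ a) k = a k - a (k+1)`. -/
def Δ (a : ℕ → ℝ) : ℕ → ℝ := fun k => a k - a (k + 1)

open Filter Topology

/-- The shift operator. -/
def shiftOp : Module.End ℝ (ℕ → ℝ) where
  toFun a := fun k => a (k + 1)
  map_add' _ _ := rfl
  map_smul' _ _ := rfl

lemma shiftOp_pow (i : ℕ) (a : ℕ → ℝ) (k : ℕ) : (shiftOp ^ i) a k = a (k + i) := by
  induction i generalizing k with
  | zero => simp
  | succ i ih =>
    rw [pow_succ', Module.End.mul_apply]
    change (shiftOp ^ i) a (k + 1) = _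
    rw [ih]; congr 1; ring

lemma deltaOp_pow (i : ℕ) (a : ℕ → ℝ) : ((1 - shiftOp) ^ i) a = Δ^[i] a := by
  induction i with
  | zero => simp
  | succ i ih =>
    rw [pow_succ', Module.End.mul_apply, Function.iterate_succ_apply', ih]
    rfl

lemma binom_id (a : ℕ → ℝ) (m k : ℕ) :
    ∑ i ∈ Finset.range (m + 1), (m.choose i : ℝ) * (Δ^[m - i] a) (i + k) = a k := by
  have hc : Commute shiftOp (1 - shiftOp) :=
    (Commute.one_right _).sub_right (Commute.refl _)
  have h := hc.add_pow m
  rw [add_sub_cancel, one_pow] at h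
  have h2 := congrFun (congrArg (fun f : Module.End ℝ (ℕ → ℝ) => f a) h) k
  simp only [Module.End.one_apply, LinearMap.sum_apply, Finset.sum_apply] at h2
  rw [h2]
  refine Finset.sum_congr rfl fun i _ => ?_
  rw [← nsmul_eq_mul', LinearMap.smul_apply, Pi.smul_apply, nsmul_eq_mul, Module.End.mul_apply,
    shiftOp_pow, deltaOp_pow, add_comm k i]

lemma moment_id (a : ℕ → ℝ) (m k : ℕ) :
    ∑ j ∈ Finset.range (m + k + 1), (((m + k).choose j : ℝ) * (Δ^[m + k - j] a) j) *
      ((j.descFactorial k : ℝ) / ((m + k).descFactorial k : ℝ)) = a k := by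
  have hD : ((m + k).descFactorial k : ℝ) ≠ 0 := by
    have : (m + k).descFactorial k ≠ 0 := by
      rw [Ne, Nat.descFactorial_eq_zero_iff_lt]; omega
    exact_mod_cast this
  rw [show m + k + 1 = k + (m + 1) by ring, Finset.sum_range_add, Finset.sum_eq_zero, zero_add,
    ← binom_id a m k]
  · refine Finset.sum_congr rfl fun i hi => ?_
    have hi : i ≤ m := by simpa [Nat.lt_succ_iff] using hi
    rw [show m + k - (k + i) = m - i by omega, add_comm k i]
    have key : (m + k).choose (i + k) * (i + k).descFactorial k
        = (m + k).descFactorial k * m.choose i := by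
      have := Nat.choose_mul (n := m + k) (k := i + k) (s := k) (by omega)
      rw [Nat.descFactorial_eq_factorial_mul_choose, Nat.descFactorial_eq_factorial_mul_choose]
      simp only [Nat.add_sub_cancel] at this
      linear_combination (k.factorial) * this
    have key' : ((m + k).choose (i + k) : ℝ) * (i + k).descFactorial k
        = (m + k).descFactorial k * m.choose i := by exact_mod_cast key
    field_simp
    linear_combination ((Δ^[m - i] a) (i + k)) * key'
  · intro j hj
    rw [Nat.descFactorial_eq_zero_iff_lt.2 (Finset.mem_range.1 hj)]
    simp

lemma unif (k : ℕ) : ∃ e : ℕ → ℝ, Tendsto e atTop (𝓝 0) ∧ ∀ n, k ≤ n → ∀ j ≤ n,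
    |(j.descFactorial k : ℝ) / (n.descFactorial k : ℝ) - ((j : ℝ) / n) ^ k| ≤ e n := by
  induction k with
  | zero => exact ⟨fun _ => 0, tendsto_const_nhds, by simp⟩
  | succ k ih =>
    obtain ⟨e, he, h⟩ := ih
    refine ⟨fun n => e n + k / ((n : ℝ) - k), ?_, ?_⟩
    · rw [← add_zero (0 : ℝ)]
      refine he.add (Tendsto.div_atTop tendsto_const_nhds ?_)
      exact tendsto_atTop_add_const_right _ (-(k : ℝ)) tendsto_natCast_atTop_atTop
    · intro n hn j hj
      have h1 := h n (by omega) j hj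
      have hn' : (k : ℝ) + 1 ≤ n := by exact_mod_cast hn
      have hj' : (j : ℝ) ≤ n := by exact_mod_cast hj
      have hk0 : (0 : ℝ) ≤ k := by positivity
      have hj0 : (0 : ℝ) ≤ j := by positivity
      have hn0 : (0 : ℝ) < n := by linarith
      have hnk : (0 : ℝ) < n - k := by linarith
      rw [Nat.descFactorial_succ, Nat.descFactorial_succ, pow_succ]
      push_cast
      rw [mul_comm ((j - k : ℕ) : ℝ), mul_comm ((n - k : ℕ) : ℝ), mul_div_mul_comm]
      rw [Nat.cast_sub (show k ≤ n by omega)]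
      set x := (j.descFactorial k : ℝ) / (n.descFactorial k : ℝ) with hx
      have hx0 : 0 ≤ x := by positivity
      have hx1 : x ≤ 1 := by
        apply div_le_one_of_le₀ _ (by positivity)
        exact_mod_cast Nat.descFactorial_le k hj
      have ht0 : 0 ≤ (j : ℝ) / n := by positivity
      have ht1 : (j : ℝ) / n ≤ 1 := div_le_one_of_le₀ hj' hn0.le
      have h2 : |((j - k : ℕ) : ℝ) / (n - k) - j / n| ≤ k / ((n : ℝ) - k) := by
        rcases le_total k j with hkj | hkj
        · rw [Nat.cast_sub hkj]
          have e1 : ((j : ℝ) - k) / (n - k) - j / n = - (k / (n - k) * (1 - j / n)) := by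
            field_simp; ring
          rw [e1, abs_neg, abs_of_nonneg (mul_nonneg (by positivity) (by linarith))]
          exact mul_le_of_le_one_right (by positivity) (by linarith)
        · rw [Nat.sub_eq_zero_of_le hkj]
          simp only [Nat.cast_zero, zero_div, zero_sub, abs_neg]
          rw [abs_of_nonneg ht0]
          have : (j : ℝ) ≤ k := by exact_mod_cast hkj
          exact div_le_div₀ hk0 this hnk (by linarith)
      set y := ((j - k : ℕ) : ℝ) / ((n : ℝ) - k)
      set t := (j : ℝ) / n
      calc |x * y - t ^ k * t| = |(x - t ^ k) * t + x * (y - t)| := by congr 1; ring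
        _ ≤ |(x - t ^ k) * t| + |x * (y - t)| := abs_add_le _ _
        _ = |x - t ^ k| * t + x * |y - t| := by
            rw [abs_mul, abs_mul, abs_of_nonneg ht0, abs_of_nonneg hx0]
        _ ≤ |x - t ^ k| + |y - t| :=
            add_le_add (mul_le_of_le_one_right (abs_nonneg _) ht1)
              (mul_le_of_le_one_left (abs_nonneg _) hx1)
        _ ≤ _ := add_le_add h1 h2

/-- The approximating measures. -/
noncomputable def apxMeasure (a : ℕ → ℝ) (n : ℕ) : Measure unitInterval :=
  ∑ j ∈ Finset.range (n + 1), ENNReal.ofReal ((n.choose j : ℝ) * (Δ^[n - j] a) j) •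
    Measure.dirac (Set.projIcc (0 : ℝ) 1 zero_le_one ((j : ℝ) / n))

lemma apx_prob (a : ℕ → ℝ) (h0 : a 0 = 1) (h : ∀ n k : ℕ, 0 ≤ (Δ^[n] a) k) (n : ℕ) :
    IsProbabilityMeasure (apxMeasure a n) := by
  constructor
  simp only [apxMeasure, Measure.coe_finsetSum, Finset.sum_apply, Measure.smul_apply,
    measure_univ, smul_eq_mul, mul_one]
  rw [← ENNReal.ofReal_sum_of_nonneg fun j _ => mul_nonneg (by positivity) (h _ _)]
  have := binom_id a n 0
  simp only [add_zero] at this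
  rw [this, h0, ENNReal.ofReal_one]

lemma apx_integral (a : ℕ → ℝ) (h : ∀ n k : ℕ, 0 ≤ (Δ^[n] a) k) (n k : ℕ) :
    ∫ x : unitInterval, (x : ℝ) ^ k ∂(apxMeasure a n) =
    ∑ j ∈ Finset.range (n + 1), ((n.choose j : ℝ) * (Δ^[n - j] a) j) * ((j : ℝ) / n) ^ k := by
  rw [apxMeasure, integral_finsetSum_measure]
  · refine Finset.sum_congr rfl fun j hj => ?_
    have hj : j ≤ n := by simpa [Nat.lt_succ_iff] using hj
    rw [integral_smul_measure, integral_dirac, ENNReal.toReal_ofReal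
      (mul_nonneg (by positivity) (h _ _)), smul_eq_mul, Set.projIcc_of_mem]
    exact ⟨by positivity, div_le_one_of_le₀ (by exact_mod_cast hj) (by positivity)⟩
  · intro j _
    refine Integrable.smul_measure ?_ ENNReal.ofReal_ne_top
    exact (integrable_dirac (by simp))

lemma apx_tendsto (a : ℕ → ℝ) (h0 : a 0 = 1) (h : ∀ n k : ℕ, 0 ≤ (Δ^[n] a) k) (k : ℕ) :
    Tendsto (fun n => ∫ x : unitInterval, (x : ℝ) ^ k ∂(apxMeasure a n)) atTop (𝓝 (a k)) := by
  obtain ⟨e, he, hb⟩ := unif k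
  rw [tendsto_iff_dist_tendsto_zero]
  refine squeeze_zero' (Eventually.of_forall fun _ => dist_nonneg) ?_ he
  filter_upwards [eventually_ge_atTop k] with n hn
  obtain ⟨m, rfl⟩ : ∃ m, n = m + k := ⟨n - k, by omega⟩
  rw [apx_integral a h, dist_comm, Real.dist_eq, ← moment_id a m k, ← Finset.sum_sub_distrib]
  refine (Finset.abs_sum_le_sum_abs _ _).trans ?_
  have h1 := binom_id a (m + k) 0
  simp only [add_zero] at h1
  calc _ ≤ ∑ j ∈ Finset.range (m + k + 1),
        (((m + k).choose j : ℝ) * (Δ^[m + k - j] a) j) * e (m + k) := by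
        refine Finset.sum_le_sum fun j hj => ?_
        have hj : j ≤ m + k := by simpa [Nat.lt_succ_iff] using hj
        have hw : 0 ≤ ((m + k).choose j : ℝ) * (Δ^[m + k - j] a) j :=
          mul_nonneg (by positivity) (h _ _)
        rw [← mul_sub, abs_mul, abs_of_nonneg hw]
        exact mul_le_mul_of_nonneg_left (hb _ hn j hj) hw
    _ = e (m + k) := by rw [← Finset.sum_mul, h1, h0, one_mul]

theorem stmt14 (a : ℕ → ℝ) (h0 : a 0 = 1) (hpos : ∀ k, 0 ≤ a k) :
    (∃ μ : Measure ℝ, IsProbabilityMeasure μ ∧ μ (Set.Icc (0:ℝ) 1)ᶜ = 0 ∧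
        ∀ k : ℕ, a k = ∫ t, t ^ k ∂μ) ↔
    (∀ n k : ℕ, 0 ≤ (Δ^[n] a) k) := by
  constructor
  · rintro ⟨μ, hμ, hs, hm⟩
    have hae : ∀ᵐ t ∂μ, t ∈ Set.Icc (0 : ℝ) 1 := by
      rw [ae_iff]; exact hs
    have hint : ∀ n k : ℕ, Integrable (fun t : ℝ => t ^ k * (1 - t) ^ n) μ := by
      intro n k
      refine Integrable.of_bound (C := 1) (by fun_prop) ?_
      filter_upwards [hae] with t ht
      have h1 : 0 ≤ 1 - t := by linarith [ht.2]
      rw [Real.norm_of_nonneg (mul_nonneg (pow_nonneg ht.1 _) (pow_nonneg h1 _))]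
      exact mul_le_one₀ (pow_le_one₀ ht.1 ht.2) (pow_nonneg h1 _)
        (pow_le_one₀ h1 (by linarith [ht.1]))
    have key : ∀ n k : ℕ, (Δ^[n] a) k = ∫ t, t ^ k * (1 - t) ^ n ∂μ := by
      intro n
      induction n with
      | zero => intro k; simp [hm]
      | succ n ih =>
        intro k
        rw [Function.iterate_succ_apply']
        simp only [Δ] at ih ⊢
        rw [ih, ih, ← integral_sub (hint _ _) (hint _ _)]
        congr 1; ext t; ring
    intro n k
    rw [key]
    apply integral_nonneg_of_ae
    filter_upwards [hae] with t ht
    exact mul_nonneg (pow_nonneg ht.1 _) (pow_nonneg (by linarith [ht.2]) _)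
  · intro h
    let P : ℕ → ProbabilityMeasure unitInterval := fun n => ⟨apxMeasure a n, apx_prob a h0 h n⟩
    let U : Ultrafilter ℕ := Ultrafilter.of atTop
    have hU : (U : Filter ℕ) ≤ atTop := Ultrafilter.of_le _
    obtain ⟨ν, -, hν⟩ := isCompact_univ.ultrafilter_le_nhds (U.map P) (by simp)
    have hν' : Tendsto P U (𝓝 ν) := hν
    have hmeas : MeasurableEmbedding (Subtype.val : unitInterval → ℝ) :=
      MeasurableEmbedding.subtype_coe measurableSet_Icc
    refine ⟨(ν : Measure unitInterval).map Subtype.val,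
      Measure.isProbabilityMeasure_map measurable_subtype_coe.aemeasurable, ?_, ?_⟩
    · rw [hmeas.map_apply]
      convert measure_empty (μ := (ν : Measure unitInterval))
      ext x
      simpa using x.2
    · intro k
      rw [hmeas.integral_map]
      have h1 := (ProbabilityMeasure.tendsto_iff_forall_integral_tendsto.1 hν')
        (BoundedContinuousFunction.mkOfCompact
          ⟨fun x : unitInterval => (x : ℝ) ^ k, by fun_prop⟩)
      exact tendsto_nhds_unique ((apx_tendsto a h0 h k).mono_left hU) h1
end
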